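/- For every probability measure μ on ℝ there exists a unique probability measure μ^♭ (the El Gordo transform of μ) such that G_{μ^♭}(z)² = G_μ(z)/z for all z ∈ ℂ₊. Moreover, μ^♭ = μ if and only if μ = δ₀, the point mass at 0; that is, δ₀ is the unique fixed point of the El Gordo transform. -/

import Mathlib

open MeasureTheory Complex

/-- The Cauchy transform of a measure on ℝ. -/
noncomputable def cauchy (μ : Measure ℝ) (z : ℂ) : ℂ := ∫ t, (z - (t : ℂ))⁻¹ ∂μ

open Filter Topology

lemma ker_ne {z : ℂ} (hz : 0 < z.im) (t : ℝ) : z - (t : ℂ) ≠ 0 := by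
  intro h
  have := congrArg Complex.im h
  simp at this
  linarith

lemma ker_cont {z : ℂ} (hz : 0 < z.im) : Continuous (fun t : ℝ => (z - (t : ℂ))⁻¹) :=
  Continuous.inv₀ (by fun_prop) (ker_ne hz)

lemma ker_bound {z : ℂ} (hz : 0 < z.im) (t : ℝ) : ‖(z - (t : ℂ))⁻¹‖ ≤ z.im⁻¹ := by
  rw [norm_inv]
  apply inv_anti₀ hz
  have := Complex.abs_im_le_norm (z - (t : ℂ))
  simp at this
  exact (le_abs_self _).trans this

lemma ker_integrable (ρ : Measure ℝ) [IsFiniteMeasure ρ] {z : ℂ} (hz : 0 < z.im) :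
    Integrable (fun t : ℝ => (z - (t : ℂ))⁻¹) ρ :=
  Integrable.of_bound (ker_cont hz).aestronglyMeasurable z.im⁻¹
    (Eventually.of_forall (ker_bound hz))

lemma cauchy_bound (ρ : Measure ℝ) [IsProbabilityMeasure ρ] {z : ℂ} (hz : 0 < z.im) :
    ‖cauchy ρ z‖ ≤ z.im⁻¹ := by
  have := norm_integral_le_of_norm_le_const (μ := ρ) (Eventually.of_forall (ker_bound hz))
  simpa [cauchy] using this

lemma ker_im {z : ℂ} (t : ℝ) : ((z - (t : ℂ))⁻¹).im = - (z.im / ((z.re - t) ^ 2 + z.im ^ 2)) := by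
  rw [Complex.inv_im, Complex.normSq_apply]
  simp
  ring

lemma cauchy_im (ρ : Measure ℝ) [IsFiniteMeasure ρ] {z : ℂ} (hz : 0 < z.im) :
    (cauchy ρ z).im = - ∫ t, z.im / ((z.re - t) ^ 2 + z.im ^ 2) ∂ρ := by
  have h := integral_im (𝕜 := ℂ) (ker_integrable ρ hz)
  simp only [RCLike.im_eq_complex_im] at h
  rw [cauchy, ← h, ← integral_neg]
  simp_rw [ker_im]

lemma pk_integrable (ρ : Measure ℝ) [IsFiniteMeasure ρ] {z : ℂ} (hz : 0 < z.im) :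
    Integrable (fun t : ℝ => z.im / ((z.re - t) ^ 2 + z.im ^ 2)) ρ := by
  have := (ker_integrable ρ hz).im.neg
  refine this.congr (Eventually.of_forall fun t => ?_)
  change -((z - (t : ℂ))⁻¹).im = _
  rw [ker_im, neg_neg]

lemma cauchy_im_neg (ρ : Measure ℝ) [IsProbabilityMeasure ρ] {z : ℂ} (hz : 0 < z.im) :
    (cauchy ρ z).im < 0 := by
  rw [cauchy_im ρ hz, neg_lt_zero]
  have hp : ∀ t : ℝ, 0 < z.im / ((z.re - t) ^ 2 + z.im ^ 2) := fun t => by positivity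
  rw [integral_pos_iff_support_of_nonneg (fun t => (hp t).le) (pk_integrable ρ hz)]
  have : Function.support (fun t : ℝ => z.im / ((z.re - t) ^ 2 + z.im ^ 2)) = Set.univ := by
    ext t; simpa only [Function.mem_support, Set.mem_univ, iff_true] using (hp t).ne'
  rw [this]; simp

lemma cauchy_diff (ρ : Measure ℝ) [IsProbabilityMeasure ρ] :
    DifferentiableOn ℂ (cauchy ρ) {z | 0 < z.im} := by
  have h : cauchy ρ = fun z => - resolventTransform ρ z := by
    ext z
    rw [cauchy, resolventTransform_def, ← integral_neg]
    congr 1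
    ext t
    simp only [resolvent, Ring.inverse_eq_inv', ← inv_neg, neg_sub]
    simp
  rw [h]
  intro z hz
  refine (hasDerivAt_resolventTransform z ?_).differentiableAt.neg.differentiableWithinAt
  rintro ⟨x, -, rfl⟩
  simp at hz

lemma cauchy_mass (ρ : Measure ℝ) [IsFiniteMeasure ρ] :
    Tendsto (fun y : ℝ => (y * I) * cauchy ρ (y * I)) atTop (𝓝 (ρ.real Set.univ : ℂ)) := by
  have h1 : (ρ.real Set.univ : ℂ) = ∫ t, (1 : ℂ) ∂ρ := by simp
  rw [h1]
  simp_rw [cauchy, ← integral_const_mul]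
  refine tendsto_integral_filter_of_dominated_convergence (fun _ => 1) ?_ ?_ ?_ ?_
  · filter_upwards [eventually_gt_atTop 0] with y hy
    exact ((ker_cont (z := y * I) (by simpa)).const_mul _).aestronglyMeasurable
  · filter_upwards [eventually_gt_atTop 0] with y hy
    refine Eventually.of_forall fun t => ?_
    have := ker_bound (z := y * I) (by simpa) t
    rw [norm_mul]
    calc _ ≤ ‖(y : ℂ) * I‖ * _ := mul_le_mul_of_nonneg_left this (norm_nonneg _)
      _ = 1 := by simp [abs_of_pos hy, hy.ne']
  · simp
  · refine Eventually.of_forall fun t => ?_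
    have h2 : Tendsto (fun y : ℝ => (1 - (t : ℂ) * (-I) * ((y⁻¹ : ℝ) : ℂ))⁻¹) atTop
        (𝓝 (1 - (t : ℂ) * (-I) * ((0 : ℝ) : ℂ))⁻¹) := by
      refine Tendsto.inv₀ ?_ (by simp)
      refine tendsto_const_nhds.sub (tendsto_const_nhds.mul ?_)
      exact (Complex.continuous_ofReal.tendsto _).comp tendsto_inv_atTop_zero
    simp only [ofReal_zero, mul_zero, sub_zero, inv_one] at h2
    refine h2.congr' ?_
    filter_upwards [eventually_gt_atTop 0] with y hy
    have hy' : (y : ℂ) ≠ 0 := by exact_mod_cast hy.ne'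
    have h3 := ker_ne (z := y * I) (by simpa) t
    have e : (1 - (t : ℂ) * (-I) * ((y⁻¹ : ℝ) : ℂ)) = (y * I - t) / (y * I) := by
      push_cast
      field_simp
      ring_nf
      simp
      ring
    rw [e, inv_div, div_eq_mul_inv]

lemma cauchy_charFun (ρ : Measure ℝ) [IsProbabilityMeasure ρ] (s : ℝ) {y : ℝ} (hy : 0 < y) :
    ∫ x : ℝ, Complex.exp (s * x * I) * (-(cauchy ρ (x + y * I)).im : ℝ) =
      charFun ρ s * ∫ x : ℝ, Complex.exp (s * x * I) * ((y / (x ^ 2 + y ^ 2) : ℝ) : ℂ) := by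
  have hz : ∀ x : ℝ, 0 < ((x : ℂ) + y * I).im := fun x => by simpa
  have e1 : ∀ x : ℝ, Complex.exp (s * x * I) * (-(cauchy ρ (x + y * I)).im : ℝ) =
      ∫ t, Complex.exp (s * x * I) * ((y / ((x - t) ^ 2 + y ^ 2) : ℝ) : ℂ) ∂ρ := by
    intro x
    rw [integral_const_mul, integral_complex_ofReal, cauchy_im ρ (hz x), neg_neg]
    simp
  simp_rw [e1]
  have hint : Integrable (fun x : ℝ => y / (x ^ 2 + y ^ 2)) := by
    have h := (integrable_inv_one_add_sq.comp_div hy.ne').const_mul y⁻¹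
    refine h.congr (Eventually.of_forall fun x => ?_)
    simp only
    field_simp
    ring
  have hpm : Integrable (fun p : ℝ × ℝ => Complex.exp (s * p.1 * I) *
      ((y / ((p.1 - p.2) ^ 2 + y ^ 2) : ℝ) : ℂ)) (volume.prod ρ) := by
    have hc : Continuous (fun p : ℝ × ℝ => Complex.exp (s * p.1 * I) *
      ((y / ((p.1 - p.2) ^ 2 + y ^ 2) : ℝ) : ℂ)) := by
      have : ∀ p : ℝ × ℝ, (p.1 - p.2) ^ 2 + y ^ 2 ≠ 0 := fun p => by positivity
      fun_prop (disch := assumption)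
    rw [integrable_prod_iff' hc.aestronglyMeasurable]
    have en : ∀ a b : ℝ, ‖Complex.exp (s * a * I) * ((y / ((a - b) ^ 2 + y ^ 2) : ℝ) : ℂ)‖ =
        y / ((a - b) ^ 2 + y ^ 2) := by
      intro a b
      have : ‖Complex.exp (s * a * I)‖ = 1 := by
        exact_mod_cast Complex.norm_exp_ofReal_mul_I (s * a)
      rw [norm_mul, this, one_mul, Complex.norm_real, Real.norm_of_nonneg (by positivity)]
    constructor
    · refine Eventually.of_forall fun t => ?_
      have h := hint.comp_sub_right t
      refine h.mono' ?_ (Eventually.of_forall fun x => (en x t).le)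
      exact (hc.comp (by fun_prop : Continuous fun x : ℝ => (x, t))).aestronglyMeasurable
    · simp only [en]
      have : ∀ t : ℝ, ∫ x : ℝ, y / ((x - t) ^ 2 + y ^ 2) = ∫ x : ℝ, y / (x ^ 2 + y ^ 2) :=
        fun t => integral_sub_right_eq_self (fun x : ℝ => y / (x ^ 2 + y ^ 2)) t
      simp only [this]
      exact integrable_const _
  rw [integral_integral_swap hpm, charFun_apply_real, ← integral_mul_const]
  congr 1
  ext t
  rw [← integral_const_mul, ← integral_add_right_eq_self _ t]
  congr 1
  ext x
  rw [← mul_assoc, ← Complex.exp_add]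
  congr 2
  · push_cast; ring
  · simp

lemma cauchy_inj (ρ σ : Measure ℝ) [IsProbabilityMeasure ρ] [IsProbabilityMeasure σ]
    (h : ∀ z : ℂ, 0 < z.im → cauchy ρ z = cauchy σ z) : ρ = σ := by
  apply Measure.ext_of_charFun
  ext s
  have hlim : Tendsto (fun y : ℝ => ∫ u : ℝ, Complex.exp (s * (y * u) * I) * (((1 + u ^ 2)⁻¹ : ℝ) : ℂ))
      (𝓝[>] 0) (𝓝 (∫ u : ℝ, Complex.exp (s * (0 * u) * I) * (((1 + u ^ 2)⁻¹ : ℝ) : ℂ))) := by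
    refine tendsto_integral_filter_of_dominated_convergence (fun u => (1 + u ^ 2)⁻¹) ?_ ?_
      integrable_inv_one_add_sq ?_
    · refine Eventually.of_forall fun y => Continuous.aestronglyMeasurable ?_
      have : ∀ u : ℝ, 1 + u ^ 2 ≠ 0 := fun u => by positivity
      fun_prop (disch := assumption)
    · refine Eventually.of_forall fun y => Eventually.of_forall fun u => ?_
      have : ‖Complex.exp (s * (y * u) * I)‖ = 1 := by
        exact_mod_cast Complex.norm_exp_ofReal_mul_I (s * (y * u))
      rw [norm_mul, this, one_mul, Complex.norm_real, Real.norm_of_nonneg (by positivity)]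
    · refine Eventually.of_forall fun u => ?_
      have : Continuous (fun y : ℝ => Complex.exp (s * (y * u) * I) * (((1 + u ^ 2)⁻¹ : ℝ) : ℂ)) := by
        fun_prop
      have h2 := this.tendsto 0
      simp only [ofReal_zero] at h2
      exact h2.mono_left nhdsWithin_le_nhds
  have hpi : (∫ u : ℝ, Complex.exp (s * (0 * u) * I) * (((1 + u ^ 2)⁻¹ : ℝ) : ℂ)) = (Real.pi : ℂ) := by
    simp only [zero_mul, mul_zero, Complex.exp_zero, one_mul]
    rw [integral_complex_ofReal, integral_univ_inv_one_add_sq]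
  rw [hpi] at hlim
  have hne : ∀ᶠ y : ℝ in 𝓝[>] (0 : ℝ),
      ∫ u : ℝ, Complex.exp (s * (y * u) * I) * (((1 + u ^ 2)⁻¹ : ℝ) : ℂ) ≠ 0 :=
    hlim.eventually_ne (by exact_mod_cast Real.pi_ne_zero)
  obtain ⟨y, hy1, hy0⟩ := (hne.and self_mem_nhdsWithin).exists
  have hy : 0 < y := hy0
  have e : ∫ x : ℝ, Complex.exp (s * x * I) * ((y / (x ^ 2 + y ^ 2) : ℝ) : ℂ) =
      ∫ u : ℝ, Complex.exp (s * (y * u) * I) * (((1 + u ^ 2)⁻¹ : ℝ) : ℂ) := by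
    have := Measure.integral_comp_mul_left
      (fun x : ℝ => Complex.exp (s * x * I) * ((y / (x ^ 2 + y ^ 2) : ℝ) : ℂ)) y
    rw [abs_of_pos (by positivity : 0 < y⁻¹), ← inv_smul_eq_iff₀ (by positivity), inv_inv] at this
    rw [← this, ← integral_smul]
    congr 1
    ext u
    have e2 : (1 + u ^ 2)⁻¹ = y * (y / ((y * u) ^ 2 + y ^ 2)) := by
      field_simp
      ring
    rw [Complex.real_smul, mul_left_comm, e2]
    push_cast
    rfl
  have h1 := cauchy_charFun ρ s hy
  have h2 := cauchy_charFun σ s hy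
  have h3 : ∀ x : ℝ, cauchy ρ (x + y * I) = cauchy σ (x + y * I) := fun x => h _ (by simpa)
  simp only [h3] at h1
  rw [h2, e] at h1
  exact (mul_right_cancel₀ hy1 h1).symm

lemma contour0 (g : ℂ → ℂ) (δ : ℝ) (hδ : 0 < δ) (hg : DifferentiableOn ℂ g {w | -δ < w.im})
    (hlim : Tendsto (fun w => ‖w‖ * ‖g w‖) (cocompact ℂ ⊓ 𝓟 {w : ℂ | 0 ≤ w.im}) (𝓝 0)) :
    Tendsto (fun R : ℝ => ∫ x in (-R)..R, g x) atTop (𝓝 0) := by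
  rw [Metric.tendsto_atTop]
  intro η hη
  have h1 : ∀ᶠ w in cocompact ℂ ⊓ 𝓟 {w : ℂ | 0 ≤ w.im}, ‖w‖ * ‖g w‖ < η / 8 :=
    hlim.eventually (gt_mem_nhds (by positivity))
  rw [eventually_inf_principal, ← Metric.cobounded_eq_cocompact,
    (hasBasis_cobounded_norm (E := ℂ)).eventually_iff] at h1
  obtain ⟨R0, -, hR0⟩ := h1
  refine ⟨max R0 1, fun R hR => ?_⟩
  have hR1 : 1 ≤ R := (le_max_right _ _).trans hR
  have hRp : 0 < R := by linarith
  have hR2 : R0 ≤ R := (le_max_left _ _).trans hR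
  have hb : ∀ w : ℂ, R ≤ ‖w‖ → 0 ≤ w.im → ‖g w‖ ≤ η / 8 / R := by
    intro w hw1 hw2
    have := hR0 (show w ∈ {w : ℂ | R0 ≤ ‖w‖} from hR2.trans hw1) hw2
    rw [le_div_iff₀ hRp]
    nlinarith [norm_nonneg (g w)]
  have hrect := Complex.integral_boundary_rect_eq_zero_of_differentiableOn g (-R : ℂ) (R + R * I)
    (hg.mono (by
      intro w hw
      rw [mem_reProdIm] at hw
      have := hw.2
      simp [Set.uIcc_of_le hRp.le] at this
      simp only [Set.mem_ofPred_eq]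
      linarith [this.1]))
  simp at hrect
  have t1 : ‖∫ x : ℝ in (-R)..R, g (x + R * I)‖ ≤ η / 8 / R * |R - -R| := by
    refine intervalIntegral.norm_integral_le_of_norm_le_const fun x hx => hb _ ?_ (by simpa using hRp.le)
    refine le_trans ?_ (Complex.abs_im_le_norm _)
    simp [le_abs_self]
  have t2 : ‖∫ y : ℝ in (0)..R, g (R + y * I)‖ ≤ η / 8 / R * |R - 0| := by
    refine intervalIntegral.norm_integral_le_of_norm_le_const fun x hx => hb _ ?_ ?_
    · refine le_trans ?_ (Complex.abs_re_le_norm _)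
      simp [le_abs_self]
    · rw [Set.uIoc_of_le hRp.le] at hx; simpa using hx.1.le
  have t3 : ‖∫ y : ℝ in (0)..R, g (-R + y * I)‖ ≤ η / 8 / R * |R - 0| := by
    refine intervalIntegral.norm_integral_le_of_norm_le_const fun x hx => hb _ ?_ ?_
    · refine le_trans ?_ (Complex.abs_re_le_norm _)
      simp [le_abs_self]
    · rw [Set.uIoc_of_le hRp.le] at hx; simpa using hx.1.le
  have e : ∫ x in (-R)..R, g x = (∫ x : ℝ in (-R)..R, g (x + R * I)) -
      I * (∫ y : ℝ in (0)..R, g (R + y * I)) + I * ∫ y : ℝ in (0)..R, g (-R + y * I) := by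
    linear_combination hrect
  rw [dist_zero_right, e]
  rw [abs_of_pos (by linarith)] at t1 t2 t3
  have n1 : η / 8 / R * (R - -R) = η / 4 := by field_simp; ring
  have n2 : η / 8 / R * (R - 0) = η / 8 := by field_simp; ring
  rw [n1] at t1
  rw [n2] at t2 t3
  refine (norm_add_le _ _).trans_lt ?_
  refine (add_le_add_left (norm_sub_le _ _) _).trans_lt ?_
  simp only [norm_mul, norm_I, one_mul]
  linarith

lemma ratio_bdd (c : ℂ) : ∀ᶠ w in cocompact ℂ, ‖w‖ ≤ 2 * ‖w - c‖ := by
  rw [← Metric.cobounded_eq_cocompact]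
  filter_upwards [(hasBasis_cobounded_norm (E := ℂ)).mem_of_mem (i := 2 * ‖c‖) trivial] with w hw
  have : 2 * ‖c‖ ≤ ‖w‖ := hw
  have := norm_sub_norm_le w c
  linarith

lemma decay_div (K g : ℂ → ℂ) (c : ℂ) (hK : Tendsto K (cocompact ℂ ⊓ 𝓟 {w : ℂ | 0 ≤ w.im}) (𝓝 0))
    (hg : ∀ᶠ w in cocompact ℂ, g w = K w / (w - c)) :
    Tendsto (fun w => ‖w‖ * ‖g w‖) (cocompact ℂ ⊓ 𝓟 {w : ℂ | 0 ≤ w.im}) (𝓝 0) := by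
  have h2 : Tendsto (fun w => 2 * ‖K w‖) (cocompact ℂ ⊓ 𝓟 {w : ℂ | 0 ≤ w.im}) (𝓝 0) := by
    simpa using hK.norm.const_mul 2
  refine squeeze_zero' (Eventually.of_forall fun w => by positivity) ?_ h2
  refine Eventually.filter_mono inf_le_left ?_
  have hne : ∀ᶠ w in cocompact ℂ, w ≠ c := (Set.finite_singleton c).isCompact.compl_mem_cocompact
  filter_upwards [hg, ratio_bdd c, hne] with w h1 h2 h3
  have : 0 < ‖w - c‖ := norm_pos_iff.mpr (sub_ne_zero.mpr h3)
  rw [h1, norm_div, mul_div_assoc', div_le_iff₀ this]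
  nlinarith [norm_nonneg (K w)]

lemma inv_decay (c : ℂ) : Tendsto (fun w : ℂ => (w - c)⁻¹) (cocompact ℂ ⊓ 𝓟 {w : ℂ | 0 ≤ w.im}) (𝓝 0) := by
  refine Tendsto.mono_left ?_ inf_le_left
  rw [← Metric.cobounded_eq_cocompact]
  refine tendsto_inv₀_cobounded.comp ?_
  have := (Homeomorph.subRight c).isClosedEmbedding.tendsto_cocompact
  rwa [← Metric.cobounded_eq_cocompact] at this

lemma contour1 (H : ℂ → ℂ) (δ : ℝ) (hδ : 0 < δ) (hH : DifferentiableOn ℂ H {w | -δ < w.im})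
    (hlim : Tendsto H (cocompact ℂ ⊓ 𝓟 {w : ℂ | 0 ≤ w.im}) (𝓝 0)) (c : ℂ) (hc : c.im < 0) :
    Tendsto (fun R : ℝ => ∫ x : ℝ in (-R)..R, H x / (x - c)) atTop (𝓝 0) := by
  refine contour0 (fun w => H w / (w - c)) (min δ (-c.im)) (by simp [hδ, hc]) ?_ ?_
  · refine (hH.mono ?_).div (by fun_prop) ?_
    · intro w hw
      have := min_le_left δ (-c.im)
      simp only [Set.mem_ofPred_eq] at hw ⊢
      linarith
    · intro w hw h
      have := min_le_right δ (-c.im)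
      simp only [Set.mem_ofPred_eq] at hw
      rw [sub_eq_zero.mp h] at hw
      linarith
  · exact decay_div H _ c hlim (Eventually.of_forall fun _ => rfl)

lemma pv_const (z : ℂ) (hz : 0 < z.im) :
    Tendsto (fun R : ℝ => ∫ x : ℝ in (-R)..R,
      (z - (starRingEnd ℂ) z) / ((x - (starRingEnd ℂ) z) * (x - z))) atTop (𝓝 (2 * Real.pi * I)) := by
  have e : ∀ x : ℝ, (z - (starRingEnd ℂ) z) / ((x - (starRingEnd ℂ) z) * (x - z)) =
      (2 * I / z.im) * (((1 + ((x - z.re) / z.im) ^ 2)⁻¹ : ℝ) : ℂ) := by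
    intro x
    have h1 : (x - (starRingEnd ℂ) z) * (x - z) = (((x - z.re) ^ 2 + z.im ^ 2 : ℝ) : ℂ) := by
      apply Complex.ext
      · rw [Complex.ofReal_re]; simp; ring
      · rw [Complex.ofReal_im]; simp; ring
    have h2 : (z - (starRingEnd ℂ) z) = 2 * I * z.im := by
      apply Complex.ext <;> simp ; ring
    have h3 : (1 + ((x - z.re) / z.im) ^ 2)⁻¹ = z.im ^ 2 * ((x - z.re) ^ 2 + z.im ^ 2)⁻¹ := by
      field_simp
      ring
    rw [h1, h2, h3, ofReal_mul, ofReal_inv, div_eq_mul_inv]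
    have : (z.im : ℂ) ≠ 0 := by exact_mod_cast hz.ne'
    push_cast
    field_simp
  simp_rw [e]
  have hi0 : Integrable (fun x : ℝ => (1 + ((x - z.re) / z.im) ^ 2)⁻¹) :=
    (integrable_inv_one_add_sq.comp_div hz.ne').comp_sub_right z.re
  have hi := (hi0.ofReal (𝕜 := ℂ)).const_mul (2 * I / z.im)
  have := intervalIntegral_tendsto_integral hi tendsto_neg_atTop_atBot tendsto_id
  refine this.trans (le_of_eq ?_)
  congr 1
  rw [integral_const_mul]
  have h4 : ∫ x : ℝ, (1 + ((x - z.re) / z.im) ^ 2)⁻¹ = z.im * Real.pi := by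
    rw [integral_sub_right_eq_self (fun x : ℝ => (1 + (x / z.im) ^ 2)⁻¹) z.re,
      Measure.integral_comp_div (fun x : ℝ => (1 + x ^ 2)⁻¹), integral_univ_inv_one_add_sq, abs_of_pos hz]
    rfl
  have h5 := integral_complex_ofReal (μ := volume) (f := fun x : ℝ => (1 + ((x - z.re) / z.im) ^ 2)⁻¹)
  rw [h4] at h5
  have : (z.im : ℂ) ≠ 0 := by exact_mod_cast hz.ne'
  refine (congrArg _ h5).trans ?_
  push_cast
  field_simp

lemma contour2 (H : ℂ → ℂ) (δ : ℝ) (hδ : 0 < δ) (hH : DifferentiableOn ℂ H {w | -δ < w.im})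
    (hlim : Tendsto H (cocompact ℂ ⊓ 𝓟 {w : ℂ | 0 ≤ w.im}) (𝓝 0)) (z : ℂ) (hz : 0 < z.im) :
    Tendsto (fun R : ℝ => ∫ x : ℝ in (-R)..R, H x / (x - z)) atTop (𝓝 (2 * Real.pi * I * H z)) := by
  set c := (starRingEnd ℂ) z with hc
  have hcim : c.im = - z.im := by simp [hc]
  set K : ℂ → ℂ := fun w => H w - H z * ((z - c) * (w - c)⁻¹) with hK
  have hzc : z - c ≠ 0 := by
    intro h
    have := congrArg Complex.im h
    simp [hcim] at this
    linarith
  have hKz : K z = 0 := by simp [hK, hzc]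
  set δ' := min δ z.im with hδ'
  have hδp : 0 < δ' := lt_min hδ hz
  have hopen : IsOpen {w : ℂ | -δ' < w.im} := isOpen_lt continuous_const Complex.continuous_im
  have hnec : ∀ w : ℂ, -δ' < w.im → w - c ≠ 0 := by
    intro w hw h
    have := min_le_right δ z.im
    rw [sub_eq_zero.mp h, hcim] at hw
    linarith
  have hKd : DifferentiableOn ℂ K {w | -δ' < w.im} := by
    refine (hH.mono ?_).sub ?_
    · intro w hw
      have := min_le_left δ z.im
      simp only [Set.mem_ofPred_eq] at hw ⊢
      linarith
    · exact (DifferentiableOn.inv (by fun_prop) hnec).const_mul _ |>.const_mul _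
  have hKl : Tendsto K (cocompact ℂ ⊓ 𝓟 {w : ℂ | 0 ≤ w.im}) (𝓝 0) := by
    have := hlim.sub (((inv_decay c).const_mul (z - c)).const_mul (H z))
    simpa using this
  have hds : DifferentiableOn ℂ (dslope K z) {w | -δ' < w.im} := by
    rw [Complex.differentiableOn_dslope]
    · exact hKd
    · refine hopen.mem_nhds ?_
      simp only [Set.mem_ofPred_eq]
      linarith
  have hval : ∀ w, w ≠ z → dslope K z w = K w / (w - z) := by
    intro w hw
    rw [dslope_of_ne _ hw, slope_def_field, hKz, sub_zero]
  have h0 := contour0 (dslope K z) δ' hδp hds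
    (decay_div K _ z hKl (by
      have hne : ∀ᶠ w in cocompact ℂ, w ≠ z :=
        (Set.finite_singleton z).isCompact.compl_mem_cocompact
      filter_upwards [hne] with w hw using hval w hw))
  have h1 := h0.add ((pv_const z hz).const_mul (H z))
  rw [zero_add, mul_comm] at h1
  refine h1.congr fun R => ?_
  have hne : ∀ x : ℝ, (x : ℂ) ≠ z := by
    intro x h
    rw [← h] at hz
    simp at hz
  have hnz : ∀ x : ℝ, (x : ℂ) - z ≠ 0 := fun x => sub_ne_zero.mpr (hne x)
  have hncr : ∀ x : ℝ, (x : ℂ) - c ≠ 0 := fun x => hnec _ (by simpa using hδp)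
  rw [← intervalIntegral.integral_const_mul, ← intervalIntegral.integral_add]
  · congr 1
    ext x
    rw [hval _ (hne x)]
    simp only [hK, ← hc]
    have := hnz x
    have := hncr x
    field_simp
    ring
  · apply Continuous.intervalIntegrable
    have : ContinuousOn (dslope K z) {w | -δ' < w.im} := hds.continuousOn
    exact this.comp_continuous Complex.continuous_ofReal (fun x => by simpa using hδp)
  · apply Continuous.intervalIntegrable
    refine continuous_const.mul (Continuous.div continuous_const (by fun_prop) ?_)
    exact fun x => mul_ne_zero (hncr x) (hnz x)

lemma contour3 (H : ℂ → ℂ) (δ : ℝ) (hδ : 0 < δ) (hH : DifferentiableOn ℂ H {w | -δ < w.im})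
    (hlim : Tendsto H (cocompact ℂ ⊓ 𝓟 {w : ℂ | 0 ≤ w.im}) (𝓝 0)) (z : ℂ) (hz : 0 < z.im) :
    Tendsto (fun R : ℝ => ∫ x : ℝ in (-R)..R, ((-(H x).im / Real.pi : ℝ) : ℂ) * (z - x)⁻¹) atTop
      (𝓝 (H z)) := by
  have h2 := contour2 H δ hδ hH hlim z hz
  have h1 := contour1 H δ hδ hH hlim ((starRingEnd ℂ) z) (by simpa using hz)
  have h1' := (Complex.continuous_conj.tendsto _).comp h1
  simp only [map_zero] at h1'
  have h3 := (h2.sub h1').const_mul ((2 * Real.pi * I)⁻¹)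
  have hpi : (2 * Real.pi * I : ℂ) ≠ 0 := by
    simp [Real.pi_ne_zero]
  have hpi' : (Real.pi : ℂ) ≠ 0 := by exact_mod_cast Real.pi_ne_zero
  rw [sub_zero, inv_mul_cancel_left₀ hpi] at h3
  refine h3.congr fun R => ?_
  have hcH : Continuous (fun x : ℝ => H x) :=
    hH.continuousOn.comp_continuous Complex.continuous_ofReal (fun x => by simpa using hδ)
  have hnz : ∀ x : ℝ, (x : ℂ) - z ≠ 0 := fun x h => by
    have := ker_ne hz x
    apply this
    linear_combination -h
  have hnz' : ∀ x : ℝ, (x : ℂ) - (starRingEnd ℂ) z ≠ 0 := fun x h => by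
    apply hnz x
    have := congrArg (starRingEnd ℂ) h
    simpa using this
  have econj : (starRingEnd ℂ) (∫ x : ℝ in (-R)..R, H x / (x - (starRingEnd ℂ) z)) =
      ∫ x : ℝ in (-R)..R, (starRingEnd ℂ) (H x) / (x - z) := by
    simp only [intervalIntegral, map_sub, ← integral_conj]
    simp
  simp only [Function.comp_apply]
  rw [econj, ← intervalIntegral.integral_sub, ← intervalIntegral.integral_const_mul]
  · congr 1
    ext x
    have e1 : (-(H x).im : ℂ) = - (H x - (starRingEnd ℂ) (H x)) / (2 * I) := by
      rw [Complex.sub_conj]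
      field_simp
      push_cast
      ring
    have h4 := hnz x
    have e5 : (z - (x : ℂ))⁻¹ = - ((x : ℂ) - z)⁻¹ := by rw [← inv_neg, neg_sub]
    rw [ofReal_div, ofReal_neg, e1, e5]
    have := I_ne_zero
    field_simp
  · apply Continuous.intervalIntegrable
    exact hcH.div (by fun_prop) hnz
  · apply Continuous.intervalIntegrable
    exact (Complex.continuous_conj.comp hcH).div (by fun_prop) hnz

lemma repr_meas (H : ℂ → ℂ) (δ : ℝ) (hδ : 0 < δ) (hH : DifferentiableOn ℂ H {w | -δ < w.im})
    (hlim : Tendsto H (cocompact ℂ ⊓ 𝓟 {w : ℂ | 0 ≤ w.im}) (𝓝 0))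
    (him : ∀ x : ℝ, (H x).im ≤ 0) (hb : ∀ y : ℝ, 0 < y → y * ‖H (y * I)‖ ≤ 1)
    (hmass : Tendsto (fun y : ℝ => (y * I * H (y * I)) ^ 2) atTop (𝓝 1)) :
    ∃ ρ : Measure ℝ, IsProbabilityMeasure ρ ∧ ∀ z : ℂ, 0 < z.im → cauchy ρ z = H z := by
  set p : ℝ → ℝ := fun x => -(H x).im / Real.pi with hp
  have hcH : Continuous (fun x : ℝ => H x) :=
    hH.continuousOn.comp_continuous Complex.continuous_ofReal (fun x => by simpa using hδ)
  have hpc : Continuous p := by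
    have := Complex.continuous_im.comp hcH
    exact this.neg.div_const _
  have hp0 : ∀ x, 0 ≤ p x := fun x => div_nonneg (by linarith [him x]) Real.pi_pos.le
  have hcont := contour3 H δ hδ hH hlim
  have hker : ∀ y : ℝ, 0 < y → ∀ x : ℝ, y * -((((p x : ℝ) : ℂ) * ((y * I : ℂ) - x)⁻¹).im) =
      p x * (y ^ 2 / (x ^ 2 + y ^ 2)) := by
    intro y hy x
    rw [Complex.im_ofReal_mul, ker_im]
    simp
    ring
  have hkc : ∀ y : ℝ, 0 < y → Continuous fun x => p x * (y ^ 2 / (x ^ 2 + y ^ 2)) := by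
    intro y hy
    have : ∀ x : ℝ, x ^ 2 + y ^ 2 ≠ 0 := fun x => by positivity
    fun_prop (disch := assumption)
  have hbound1 : ∀ y : ℝ, 0 < y → ∀ R : ℝ, 0 ≤ R →
      ∫ x in (-R)..R, p x * (y ^ 2 / (x ^ 2 + y ^ 2)) ≤ 1 := by
    intro y hy R hR
    have h1 := hcont (y * I) (by simpa)
    have h2 := (((Complex.continuous_im.tendsto _).comp h1).neg).const_mul y
    have h3 : y * -(H (y * I)).im ≤ 1 := by
      refine le_trans ?_ (hb y hy)
      refine mul_le_mul_of_nonneg_left ?_ hy.le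
      exact (neg_le_abs _).trans (Complex.abs_im_le_norm _)
    refine le_trans (ge_of_tendsto h2 ?_) h3
    filter_upwards [eventually_ge_atTop R] with S hS
    have e : y * -(Complex.im ∘ fun R : ℝ => ∫ x : ℝ in (-R)..R, ((-(H x).im / Real.pi : ℝ) : ℂ) * ((y * I) - x)⁻¹) S
        = ∫ x in (-S)..S, p x * (y ^ 2 / (x ^ 2 + y ^ 2)) := by
      simp only [Function.comp_apply]
      have hci : IntervalIntegrable (fun x : ℝ => ((-(H x).im / Real.pi : ℝ) : ℂ) * ((y * I) - x)⁻¹) volume (-S) S := by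
        apply Continuous.intervalIntegrable
        exact (Complex.continuous_ofReal.comp hpc).mul (ker_cont (z := y * I) (by simpa))
      have := intervalIntegral.intervalIntegral_im hci
      simp only [RCLike.im_eq_complex_im] at this
      rw [← this, ← intervalIntegral.integral_neg, ← intervalIntegral.integral_const_mul]
      congr 1
      ext x
      exact hker y hy x
    rw [e]
    refine intervalIntegral.integral_mono_interval (by linarith) (by linarith) hS
      (Eventually.of_forall fun x => mul_nonneg (hp0 x) (by positivity))
      ((hkc y hy).intervalIntegrable _ _)
  have hbound2 : ∀ R : ℝ, 0 ≤ R → ∫ x in (-R)..R, p x ≤ 1 := by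
    intro R hR
    have h1 : Tendsto (fun y : ℝ => ∫ x in (-R)..R, p x * (y ^ 2 / (x ^ 2 + y ^ 2))) atTop
        (𝓝 (∫ x in (-R)..R, p x)) := by
      refine intervalIntegral.tendsto_integral_filter_of_dominated_convergence p ?_ ?_
        (hpc.intervalIntegrable _ _) ?_
      · filter_upwards [eventually_gt_atTop 0] with y hy
        exact (hkc y hy).aestronglyMeasurable
      · filter_upwards [eventually_gt_atTop 0] with y hy
        refine Eventually.of_forall fun x _ => ?_
        rw [Real.norm_of_nonneg (mul_nonneg (hp0 x) (by positivity))]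
        refine mul_le_of_le_one_right (hp0 x) ?_
        rw [div_le_one (by positivity)]
        nlinarith [sq_nonneg x]
      · refine Eventually.of_forall fun x _ => ?_
        have h2 : Tendsto (fun y : ℝ => p x * (1 - x ^ 2 / (x ^ 2 + y ^ 2))) atTop (𝓝 (p x * (1 - 0))) := by
          refine (tendsto_const_nhds.sub ?_).const_mul _
          refine tendsto_const_nhds.div_atTop ?_
          exact tendsto_atTop_add_const_left _ _ (tendsto_pow_atTop (by norm_num))
        rw [sub_zero, mul_one] at h2
        refine h2.congr' ?_
        filter_upwards [eventually_gt_atTop 0] with y hy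
        have : x ^ 2 + y ^ 2 ≠ 0 := by positivity
        field_simp
        ring
    refine le_of_tendsto h1 ?_
    filter_upwards [eventually_gt_atTop 0] with y hy using hbound1 y hy R hR
  have hpi : Integrable p := by
    refine integrable_of_intervalIntegral_norm_bounded (a := fun R : ℝ => -R) (b := fun R : ℝ => R)
      (l := atTop) 1 (fun R => (hpc.integrableOn_Icc).mono_set Set.Ioc_subset_Icc_self)
      tendsto_neg_atTop_atBot tendsto_id ?_
    filter_upwards [eventually_ge_atTop 0] with R hR
    simp_rw [Real.norm_of_nonneg (hp0 _)]
    exact hbound2 R hR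
  set ρ : Measure ℝ := volume.withDensity (fun x => ENNReal.ofReal (p x)) with hρ
  have hfin : IsFiniteMeasure ρ := by
    refine isFiniteMeasure_withDensity ?_
    rw [← ofReal_integral_eq_lintegral_ofReal hpi (Eventually.of_forall hp0)]
    exact ENNReal.ofReal_ne_top
  have hrep : ∀ z : ℂ, 0 < z.im → cauchy ρ z = H z := by
    intro z hz
    have e : cauchy ρ z = ∫ x : ℝ, ((p x : ℝ) : ℂ) * (z - x)⁻¹ := by
      rw [cauchy, hρ, integral_withDensity_eq_integral_toReal_smul (by fun_prop)
        (Eventually.of_forall fun x => ENNReal.ofReal_lt_top)]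
      congr 1
      ext x
      rw [ENNReal.toReal_ofReal (hp0 x), Complex.real_smul]
    rw [e]
    have hi : Integrable (fun x : ℝ => ((p x : ℝ) : ℂ) * (z - x)⁻¹) := by
      refine (hpi.ofReal (𝕜 := ℂ)).mul_bdd (c := z.im⁻¹) (ker_cont hz).aestronglyMeasurable
        (Eventually.of_forall (ker_bound hz))
    have h1 := intervalIntegral_tendsto_integral hi tendsto_neg_atTop_atBot tendsto_id
    exact tendsto_nhds_unique h1 (hcont z hz)
  refine ⟨ρ, ⟨?_⟩, hrep⟩
  have h1 := (cauchy_mass ρ).pow 2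
  have h2 : (ρ.real Set.univ : ℂ) ^ 2 = 1 := by
    refine tendsto_nhds_unique h1 (hmass.congr' ?_)
    filter_upwards [eventually_gt_atTop 0] with y hy
    rw [hrep _ (by simpa)]
  have h3 : (ρ.real Set.univ) ^ 2 = 1 := by exact_mod_cast h2
  have h4 : ρ.real Set.univ = 1 := by
    have : 0 ≤ ρ.real Set.univ := measureReal_nonneg
    nlinarith
  rw [measureReal_def, ENNReal.toReal_eq_one_iff] at h4
  exact h4

lemma tail_bound (ρ : Measure ℝ) [IsProbabilityMeasure ρ] {y : ℝ} (hy : 0 < y) :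
    ρ.real (Set.Icc (-y) y)ᶜ ≤ 2 * ‖1 - (y * I * cauchy ρ (y * I)) ^ 2‖ := by
  have hz : 0 < ((y : ℂ) * I).im := by simpa
  set u := (y : ℂ) * I * cauchy ρ (y * I) with hu
  have hre : u.re = y * ∫ t, y / (t ^ 2 + y ^ 2) ∂ρ := by
    have := cauchy_im ρ hz
    simp at this
    simp [hu, this]
  have hint : Integrable (fun t : ℝ => y / (t ^ 2 + y ^ 2)) ρ := by
    simpa using pk_integrable ρ hz
  have hre0 : 0 ≤ u.re := by
    rw [hre]
    exact mul_nonneg hy.le (integral_nonneg fun t => by positivity)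
  have h1 : 1 - u.re = ∫ t, (1 - y * (y / (t ^ 2 + y ^ 2))) ∂ρ := by
    rw [integral_sub (integrable_const _) (hint.const_mul y), integral_const_mul, hre]
    simp
  have h2 : ρ.real (Set.Icc (-y) y)ᶜ * (1 / 2) ≤ 1 - u.re := by
    rw [h1]
    have hm : MeasurableSet (Set.Icc (-y) y)ᶜ := measurableSet_Icc.compl
    rw [← smul_eq_mul, ← integral_indicator_const _ hm]
    refine integral_mono ((integrable_const _).indicator hm)
      ((integrable_const _).sub (hint.const_mul y)) fun t => ?_
    have hpos : 0 < t ^ 2 + y ^ 2 := by positivity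
    have e : 1 - y * (y / (t ^ 2 + y ^ 2)) = t ^ 2 / (t ^ 2 + y ^ 2) := by
      field_simp
      ring
    by_cases ht : t ∈ (Set.Icc (-y) y)ᶜ
    · rw [Set.indicator_of_mem ht]
      simp only [e]
      rw [div_le_div_iff₀ (by norm_num) hpos]
      have : y ^ 2 ≤ t ^ 2 := by
        rw [sq_le_sq, abs_of_pos hy]
        by_contra hlt
        push Not at hlt
        exact ht (Set.mem_Icc.mpr (abs_le.mp hlt.le))
      linarith
    · rw [Set.indicator_of_notMem ht]
      simp only [e]
      positivity
  have h3 : 1 - u.re ≤ ‖1 - u‖ := by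
    have := Complex.abs_re_le_norm (1 - u)
    simp at this
    exact (le_abs_self _).trans this
  have h4 : ‖1 - u‖ ≤ ‖1 - u ^ 2‖ := by
    have e : 1 - u ^ 2 = (1 - u) * (1 + u) := by ring
    rw [e, norm_mul]
    have : 1 ≤ ‖1 + u‖ := by
      have := Complex.abs_re_le_norm (1 + u)
      simp at this
      exact le_trans (by linarith [le_abs_self (1 + u.re)]) this
    nlinarith [norm_nonneg (1 - u)]
  linarith

lemma exists_F (μ : Measure ℝ) [IsProbabilityMeasure μ] :
    ∃ F : ℂ → ℂ, DifferentiableOn ℂ F {z | 0 < z.im} ∧ (∀ z : ℂ, 0 < z.im → (F z).im < 0) ∧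
      ∀ z : ℂ, 0 < z.im → (F z) ^ 2 = cauchy μ z / z := by
  have hzs : ∀ z : ℂ, 0 < z.im → z ∈ slitPlane := fun z hz => Or.inr hz.ne'
  have hgs : ∀ z : ℂ, 0 < z.im → cauchy μ z ∈ slitPlane :=
    fun z hz => Or.inr (cauchy_im_neg μ hz).ne
  refine ⟨fun z => Complex.exp ((Complex.log (cauchy μ z) - Complex.log z) / 2), ?_, ?_, ?_⟩
  · refine DifferentiableOn.cexp (DifferentiableOn.div_const (DifferentiableOn.sub ?_ ?_) _)
    · exact (cauchy_diff μ).clog hgs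
    · exact differentiableOn_id.clog hzs
  · intro z hz
    rw [Complex.exp_im]
    refine mul_neg_of_pos_of_neg (Real.exp_pos _) ?_
    have e : ((Complex.log (cauchy μ z) - Complex.log z) / 2).im = (arg (cauchy μ z) - arg z) / 2 := by
      simp [Complex.log_im]
    rw [e]
    have a1 := Complex.arg_neg_iff.mpr (cauchy_im_neg μ hz)
    have a2 := Complex.neg_pi_lt_arg (cauchy μ z)
    have a3 := Complex.arg_le_pi z
    have a4 := Complex.arg_nonneg_iff.mpr hz.le
    exact Real.sin_neg_of_neg_of_neg_pi_lt (by linarith) (by linarith)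
  · intro z hz
    have hz0 : z ≠ 0 := slitPlane_ne_zero (hzs z hz)
    rw [← Complex.exp_nat_mul]
    push_cast
    rw [mul_div_cancel₀ _ (two_ne_zero), Complex.exp_sub, Complex.exp_log hz0,
      Complex.exp_log (slitPlane_ne_zero (hgs z hz))]

lemma unif_lim (μ : Measure ℝ) [IsProbabilityMeasure μ] :
    Tendsto (fun p : ℝ × ℝ => (p.1 * I) ^ 2 * (cauchy μ ((p.1 + p.2 : ℝ) * I) / ((p.1 + p.2 : ℝ) * I)))
      (atTop ×ˢ 𝓟 (Set.Icc 0 1)) (𝓝 1) := by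
  have hs : Tendsto (fun p : ℝ × ℝ => p.1 + p.2) (atTop ×ˢ 𝓟 (Set.Icc 0 1)) atTop := by
    refine tendsto_atTop_mono' _ ?_ (tendsto_fst (f := atTop) (g := 𝓟 (Set.Icc (0 : ℝ) 1)))
    filter_upwards [tendsto_snd.eventually (mem_principal_self (Set.Icc (0 : ℝ) 1))] with p hp
    linarith [hp.1]
  have h1 := (cauchy_mass μ).comp hs
  have hr : Tendsto (fun p : ℝ × ℝ => 1 - p.2 / (p.1 + p.2)) (atTop ×ˢ 𝓟 (Set.Icc 0 1)) (𝓝 (1 - 0)) := by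
    refine tendsto_const_nhds.sub ?_
    have h2 : Tendsto (fun p : ℝ × ℝ => 1 / (p.1 + p.2)) (atTop ×ˢ 𝓟 (Set.Icc 0 1)) (𝓝 0) :=
      tendsto_const_nhds.div_atTop hs
    refine squeeze_zero' ?_ ?_ h2
    · filter_upwards [tendsto_snd.eventually (mem_principal_self (Set.Icc (0 : ℝ) 1)),
        hs.eventually_gt_atTop 0] with p hp hp2
      exact div_nonneg hp.1 hp2.le
    · filter_upwards [tendsto_snd.eventually (mem_principal_self (Set.Icc (0 : ℝ) 1)),
        hs.eventually_gt_atTop 0] with p hp hp2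
      exact div_le_div_of_nonneg_right hp.2 hp2.le
  have hr' := (((Complex.continuous_ofReal.tendsto _).comp hr).pow 2).mul h1
  simp only [sub_zero, ofReal_one, one_pow, one_mul, probReal_univ] at hr'
  refine hr'.congr' ?_
  filter_upwards [hs.eventually_gt_atTop 0] with p hp
  have hp' : ((p.1 + p.2 : ℝ) : ℂ) ≠ 0 := by exact_mod_cast hp.ne'
  have e : (1 - p.2 / (p.1 + p.2) : ℝ) = p.1 / (p.1 + p.2) := by
    field_simp
    ring
  simp only [Function.comp_apply, e, ofReal_div]
  have := I_ne_zero
  field_simp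

lemma approx_exists (μ : Measure ℝ) [IsProbabilityMeasure μ] (F : ℂ → ℂ)
    (hd : DifferentiableOn ℂ F {z | 0 < z.im}) (him : ∀ z : ℂ, 0 < z.im → (F z).im < 0)
    (hsq : ∀ z : ℂ, 0 < z.im → (F z) ^ 2 = cauchy μ z / z) (ε : ℝ) (hε : 0 < ε) (hε1 : ε ≤ 1) :
    ∃ ρ : Measure ℝ, IsProbabilityMeasure ρ ∧ ∀ z : ℂ, 0 < z.im → cauchy ρ z = F (z + ε * I) := by
  have hnorm : ∀ z : ℂ, 0 < z.im → ‖F z‖ ^ 2 ≤ z.im⁻¹ / ‖z‖ := by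
    intro z hz
    rw [← norm_pow, hsq z hz, norm_div]
    exact div_le_div_of_nonneg_right (cauchy_bound μ hz) (norm_nonneg _)
  refine repr_meas (fun w => F (w + ε * I)) ε hε ?_ ?_ ?_ ?_ ?_
  · refine hd.comp (by fun_prop) ?_
    intro w hw
    simp only [Set.mem_ofPred_eq] at hw ⊢
    simp
    linarith
  · rw [tendsto_zero_iff_norm_tendsto_zero]
    have h1 : Tendsto (fun w : ℂ => ε⁻¹ * ‖(w - (-(ε * I)))⁻¹‖)
        (cocompact ℂ ⊓ 𝓟 {w : ℂ | 0 ≤ w.im}) (𝓝 0) := by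
      simpa only [norm_zero, mul_zero] using (inv_decay (-(ε * I))).norm.const_mul ε⁻¹
    have h2 : Tendsto (fun w : ℂ => ‖F (w + ε * I)‖ ^ 2)
        (cocompact ℂ ⊓ 𝓟 {w : ℂ | 0 ≤ w.im}) (𝓝 0) := by
      refine squeeze_zero' (Eventually.of_forall fun w => by positivity) ?_ h1
      refine Eventually.filter_mono inf_le_right ?_
      filter_upwards [mem_principal_self _] with w hw
      have hw' : 0 ≤ w.im := hw
      have hi : (w + ε * I).im = w.im + ε := by simp
      refine (hnorm (w + ε * I) (by rw [hi]; linarith)).trans ?_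
      rw [sub_neg_eq_add, norm_inv, div_eq_mul_inv, hi]
      refine mul_le_mul_of_nonneg_right ?_ (by positivity)
      exact inv_anti₀ hε (by linarith)
    have h3 := (Real.continuous_sqrt.tendsto 0).comp h2
    simp only [Real.sqrt_zero] at h3
    refine h3.congr fun w => ?_
    simp [Real.sqrt_sq (norm_nonneg _)]
  · intro x
    exact (him _ (by simpa using hε)).le
  · intro y hy
    have hw : ((y : ℂ) * I + ε * I) = ((y + ε : ℝ) : ℂ) * I := by push_cast; ring
    have hpos : 0 < y + ε := by linarith
    rw [hw]
    have h := hnorm (((y + ε : ℝ) : ℂ) * I) (by simpa using hpos)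
    have e1 : (((y + ε : ℝ) : ℂ) * I).im = y + ε := by simp
    have e2 : ‖((y + ε : ℝ) : ℂ) * I‖ = y + ε := by
      rw [norm_mul, norm_I, mul_one, Complex.norm_real, Real.norm_of_nonneg hpos.le]
    rw [e1, e2, div_eq_mul_inv, ← sq] at h
    have h' := (sq_le_sq₀ (norm_nonneg _) (by positivity)).mp h
    calc _ ≤ y * (y + ε)⁻¹ := mul_le_mul_of_nonneg_left h' hy.le
      _ ≤ 1 := by
        rw [← div_eq_mul_inv, div_le_one hpos]
        linarith
  · have hm : Tendsto (fun y : ℝ => (y, ε)) atTop (atTop ×ˢ 𝓟 (Set.Icc 0 1)) :=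
      tendsto_id.prodMk (tendsto_principal.mpr (Eventually.of_forall fun _ => ⟨hε.le, hε1⟩))
    refine ((unif_lim μ).comp hm).congr' ?_
    filter_upwards [eventually_gt_atTop 0] with y hy
    have hw : ((y : ℂ) * I + ε * I) = ((y + ε : ℝ) : ℂ) * I := by push_cast; ring
    simp only [Function.comp_apply]
    have hp : 0 < y + ε := by linarith
    have hF := hsq (((y + ε : ℝ) : ℂ) * I) (by simpa using hp)
    rw [hw, ← hF, ← mul_pow]

lemma elGordo_exists (μ : Measure ℝ) [IsProbabilityMeasure μ] :
    ∃ ρ : Measure ℝ, IsProbabilityMeasure ρ ∧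
        ∀ z : ℂ, 0 < z.im → (cauchy ρ z) ^ 2 = cauchy μ z / z := by
  obtain ⟨F, hd, him, hsq⟩ := exists_F μ
  set ε : ℕ → ℝ := fun n => 1 / ((n : ℝ) + 1) with hεdef
  have hε : ∀ n, 0 < ε n := fun n => by simp only [hεdef]; positivity
  have hε1 : ∀ n, ε n ≤ 1 := fun n => by
    simp only [hεdef]
    rw [div_le_one (by positivity)]
    linarith [Nat.cast_nonneg (α := ℝ) n]
  have hε0 : Tendsto ε atTop (𝓝 0) := tendsto_one_div_add_atTop_nhds_zero_nat
  choose r hr hrF using fun n => approx_exists μ F hd him hsq (ε n) (hε n) (hε1 n)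
  set P : ℕ → ProbabilityMeasure ℝ := fun n => ⟨r n, hr n⟩ with hP
  have htight : IsTightMeasureSet {((ν : ProbabilityMeasure ℝ) : Measure ℝ) | ν ∈ Set.range P} := by
    rw [isTightMeasureSet_iff_exists_isCompact_measure_compl_le]
    intro η hη
    by_cases htop : η = ⊤
    · exact ⟨∅, isCompact_empty, fun _ _ => htop ▸ le_top⟩
    have hη' : 0 < η.toReal := ENNReal.toReal_pos hη.ne' htop
    have h1 := (unif_lim μ).eventually (Metric.ball_mem_nhds 1 (half_pos hη'))
    rw [eventually_prod_principal_iff] at h1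
    obtain ⟨y, h2, hy⟩ := (h1.and (eventually_gt_atTop 0)).exists
    refine ⟨Set.Icc (-y) y, isCompact_Icc, ?_⟩
    rintro _ ⟨_, ⟨n, rfl⟩, rfl⟩
    have hrn := hr n
    change r n _ ≤ η
    have h3 := tail_bound (r n) hy
    have h4 := h2 (ε n) ⟨(hε n).le, hε1 n⟩
    have hw : ((y : ℂ) * I + ε n * I) = ((y + ε n : ℝ) : ℂ) * I := by push_cast; ring
    dsimp only at h4
    rw [dist_comm, dist_eq_norm] at h4
    have hp : 0 < y + ε n := by linarith [hε n]
    have hF := hsq (((y + ε n : ℝ) : ℂ) * I) (by simpa using hp)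
    rw [← hF, ← mul_pow] at h4
    rw [hrF n _ (by simpa), hw] at h3
    rw [measureReal_def] at h3
    rw [← ENNReal.toReal_le_toReal (measure_ne_top _ _) htop]
    linarith
  have hcomp := isCompact_closure_of_isTightMeasureSet htight
  rw [isCompact_iff_ultrafilter_le_nhds] at hcomp
  set 𝒰 : Ultrafilter ℕ := Ultrafilter.of atTop with h𝒰
  obtain ⟨ρ0, -, hρ0⟩ := hcomp (𝒰.map P) (by
    rw [le_principal_iff]
    refine mem_map.mpr (Eventually.of_forall fun n => ?_)
    exact subset_closure ⟨n, rfl⟩)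
  have htend : Tendsto P 𝒰 (𝓝 ρ0) := hρ0
  refine ⟨ρ0, inferInstance, fun z hz => ?_⟩
  rw [ProbabilityMeasure.tendsto_iff_forall_integral_rclike_tendsto ℂ] at htend
  have h1 := htend (BoundedContinuousFunction.ofNormedAddCommGroup (fun t : ℝ => (z - (t : ℂ))⁻¹)
    (ker_cont hz) z.im⁻¹ (ker_bound hz))
  have h2 : Tendsto (fun n => cauchy (r n) z) 𝒰 (𝓝 (cauchy ρ0 z)) := h1
  have h3 : Tendsto (fun n => cauchy (r n) z) 𝒰 (𝓝 (F z)) := by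
    simp only [fun n => hrF n z hz]
    have hc : ContinuousAt F z := (hd.differentiableAt
      ((isOpen_lt continuous_const Complex.continuous_im).mem_nhds hz)).continuousAt
    refine Tendsto.comp hc ?_
    have h4 : Tendsto (fun n => z + (ε n : ℂ) * I) atTop (𝓝 (z + ((0 : ℝ) : ℂ) * I)) :=
      tendsto_const_nhds.add (((Complex.continuous_ofReal.tendsto _).comp hε0).mul_const _)
    simp only [ofReal_zero, zero_mul, add_zero] at h4
    exact h4.mono_left (Ultrafilter.of_le _)
  rw [tendsto_nhds_unique h2 h3, hsq z hz]

/-- existence and uniqueness of the El Gordo transform μ^♭, defined by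
G_{μ^♭}(z)² = G_μ(z)/z on ℂ₊; moreover μ itself satisfies this equation (i.e. μ^♭ = μ)
iff μ = δ₀. -/
theorem elGordo_exists_unique_and_fixed_point (μ : Measure ℝ) [IsProbabilityMeasure μ] :
    (∃! ρ : Measure ℝ, IsProbabilityMeasure ρ ∧
        ∀ z : ℂ, 0 < z.im → (cauchy ρ z) ^ 2 = cauchy μ z / z) ∧
    ((∀ z : ℂ, 0 < z.im → (cauchy μ z) ^ 2 = cauchy μ z / z) ↔ μ = Measure.dirac 0) := by
  have hdir : ∀ z : ℂ, cauchy (Measure.dirac 0) z = z⁻¹ := fun z => by simp [cauchy]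
  refine ⟨?_, ?_, ?_⟩
  · obtain ⟨ρ, hρ, h⟩ := elGordo_exists μ
    refine ⟨ρ, ⟨hρ, h⟩, ?_⟩
    rintro σ ⟨hσ, h'⟩
    refine cauchy_inj σ ρ fun z hz => ?_
    rcases sq_eq_sq_iff_eq_or_eq_neg.mp ((h' z hz).trans (h z hz).symm) with e | e
    · exact e
    · have h1 := cauchy_im_neg σ hz
      have h2 := cauchy_im_neg ρ hz
      rw [e, neg_im] at h1
      linarith
  · intro h
    refine cauchy_inj μ _ fun z hz => ?_
    rw [hdir]
    have h0 : cauchy μ z ≠ 0 := fun h0 => by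
      have := cauchy_im_neg μ hz
      simp [h0] at this
    have h1 := h z hz
    rw [sq, div_eq_mul_inv] at h1
    exact mul_left_cancel₀ h0 h1
  · rintro rfl z hz
    rw [hdir, sq, div_eq_mul_inv]
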